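/- Suppose in addition that f is continuous at Lebesgue-almost every point of [0,1]^d (equivalently, f is Riemann-integrable). Then lim_{k→∞} N_k·2^{−(d+1)k} = 0. (This is the quantitative content of Theorem 2: the probability that the quadtree walk has not halted after k levels tends to 0.) -/

import Mathlib

/-- The dyadic cube `R* = ∏_i [m_i·2^{-k}, (m_i+1)·2^{-k}]` of the level-`k` grid. -/
def dyadicCube (d k : ℕ) (m : Fin d → ℕ) : Set (Fin d → ℝ) :=
  {x | ∀ i, (m i : ℝ) / 2 ^ k ≤ x i ∧ x i ≤ ((m i : ℝ) + 1) / 2 ^ k}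

/-- The level-`k` cell `R* × [j·C·2^{-k}, (j+1)·C·2^{-k}]` is visited by `f` if
`sup_{R*} f ≥ j·C·2^{-k}` and `inf_{R*} f ≤ (j+1)·C·2^{-k}`. -/
def VisitedCell (d k : ℕ) (C : ℝ) (f : (Fin d → ℝ) → ℝ) (m : Fin d → ℕ) (j : ℕ) : Prop :=
  (j : ℝ) * C / 2 ^ k ≤ sSup (f '' dyadicCube d k m) ∧
    sInf (f '' dyadicCube d k m) ≤ ((j : ℝ) + 1) * C / 2 ^ k

/-- `N_k`, the number of level-`k` cells visited by `f`. -/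
noncomputable def Nvisited (d : ℕ) (C : ℝ) (f : (Fin d → ℝ) → ℝ) (k : ℕ) : ℕ :=
  {p : (Fin d → ℕ) × ℕ |
    (∀ i, p.1 i < 2 ^ k) ∧ p.2 < 2 ^ k ∧ VisitedCell d k C f p.1 p.2}.ncard

/-- The upper dyadic Darboux sum `I_k^+ = 2^{-dk} Σ_{R*} sup_{R*} f`. -/
noncomputable def Iplus (d : ℕ) (f : (Fin d → ℝ) → ℝ) (k : ℕ) : ℝ :=
  ((2 : ℝ) ^ (d * k))⁻¹ *
    ∑ m ∈ Fintype.piFinset (fun _ : Fin d => Finset.range (2 ^ k)),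
      sSup (f '' dyadicCube d k m)

/-- The lower dyadic Darboux sum `I_k^- = 2^{-dk} Σ_{R*} inf_{R*} f`. -/
noncomputable def Iminus (d : ℕ) (f : (Fin d → ℝ) → ℝ) (k : ℕ) : ℝ :=
  ((2 : ℝ) ^ (d * k))⁻¹ *
    ∑ m ∈ Fintype.piFinset (fun _ : Fin d => Finset.range (2 ^ k)),
      sInf (f '' dyadicCube d k m)

open MeasureTheory

open Classical in
/-- Number of visited cells above the cube with index `m`. -/
noncomputable def cnt7 (d : ℕ) (C : ℝ) (f : (Fin d → ℝ) → ℝ) (k : ℕ) (m : Fin d → ℕ) : ℕ :=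
  ((Finset.range (2 ^ k)).filter (fun j => VisitedCell d k C f m j)).card

/-- Index set of the level-`k` cubes. -/
def idx7 (d k : ℕ) : Finset (Fin d → ℕ) :=
  Fintype.piFinset (fun _ : Fin d => Finset.range (2 ^ k))

/-- Half-open dyadic cube. -/
def hcube7 (d k : ℕ) (m : Fin d → ℕ) : Set (Fin d → ℝ) :=
  Set.pi Set.univ (fun i => Set.Ico ((m i : ℝ) / 2 ^ k) (((m i : ℝ) + 1) / 2 ^ k))

/-- Step function whose integral is the normalized count. -/
noncomputable def step7 (d : ℕ) (C : ℝ) (f : (Fin d → ℝ) → ℝ) (k : ℕ) (x : Fin d → ℝ) : ℝ :=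
  ∑ m ∈ idx7 d k, (hcube7 d k m).indicator (fun _ => (cnt7 d C f k m : ℝ) / 2 ^ k) x

lemma nvisited_eq7 (d : ℕ) (C : ℝ) (f : (Fin d → ℝ) → ℝ) (k : ℕ) :
    Nvisited d C f k = ∑ m ∈ idx7 d k, cnt7 d C f k m := by
  classical
  unfold Nvisited cnt7
  rw [← Finset.card_sigma, ← Set.ncard_coe_finset]
  refine Set.ncard_congr (fun p _ => (⟨p.1, p.2⟩ : (_ : Fin d → ℕ) × ℕ)) ?_ ?_ ?_
  · rintro ⟨m, j⟩ ⟨h1, h2, h3⟩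
    simp only [Finset.coe_sigma, Set.mem_sigma_iff, Finset.mem_coe, Finset.mem_filter,
      Finset.mem_range, idx7, Fintype.mem_piFinset]
    exact ⟨h1, h2, h3⟩
  · rintro ⟨m, j⟩ ⟨m', j'⟩ _ _ h
    simpa using h
  · rintro ⟨m, j⟩ h
    simp only [Finset.coe_sigma, Set.mem_sigma_iff, Finset.mem_coe, Finset.mem_filter,
      Finset.mem_range, idx7, Fintype.mem_piFinset] at h
    exact ⟨(m, j), ⟨h.1, h.2.1, h.2.2⟩, rfl⟩

lemma card_le7 (s : Finset ℕ) (A B : ℝ) (hAB : A ≤ B) (h : ∀ j ∈ s, A ≤ j ∧ (j : ℝ) ≤ B) :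
    (s.card : ℝ) ≤ B - A + 1 := by
  rcases s.eq_empty_or_nonempty with rfl | hs
  · simp; linarith
  · have hsub : s ⊆ Finset.Icc (s.min' hs) (s.max' hs) := fun j hj =>
      Finset.mem_Icc.2 ⟨s.min'_le j hj, s.le_max' j hj⟩
    have h1 := Finset.card_le_card hsub
    rw [Nat.card_Icc] at h1
    have h2 := s.min'_le _ (s.max'_mem hs)
    have h3 : (s.card : ℝ) + (s.min' hs : ℕ) ≤ (s.max' hs : ℕ) + 1 := by
      have : s.card + s.min' hs ≤ s.max' hs + 1 := by omega
      exact_mod_cast this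
    have h4 := (h _ (s.min'_mem hs)).1
    have h5 := (h _ (s.max'_mem hs)).2
    linarith

lemma hcube_sub7 (d k : ℕ) (m : Fin d → ℕ) : hcube7 d k m ⊆ dyadicCube d k m := by
  intro x hx i
  have := hx i (Set.mem_univ i)
  exact ⟨this.1, this.2.le⟩

lemma cube_sub7 (d k : ℕ) (m : Fin d → ℕ) (hm : m ∈ idx7 d k) :
    dyadicCube d k m ⊆ Set.Icc 0 1 := by
  intro x hx
  simp only [idx7, Fintype.mem_piFinset, Finset.mem_range] at hm
  refine ⟨fun i => ?_, fun i => ?_⟩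
  · exact le_trans (by positivity) (hx i).1
  · refine (hx i).2.trans ?_
    rw [Pi.one_apply, div_le_one (by positivity)]
    have : m i + 1 ≤ 2 ^ k := hm i
    exact_mod_cast this

lemma hcube_unique7 (d k : ℕ) (m m' : Fin d → ℕ) (x : Fin d → ℝ)
    (h : x ∈ hcube7 d k m) (h' : x ∈ hcube7 d k m') : m' = m := by
  funext i
  have h1 := h i (Set.mem_univ i)
  have h2 := h' i (Set.mem_univ i)
  have hp : (0 : ℝ) < 2 ^ k := by positivity
  have a := lt_of_le_of_lt h1.1 h2.2
  have b := lt_of_le_of_lt h2.1 h1.2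
  rw [div_lt_div_iff_of_pos_right hp] at a b
  have a' : m i < m' i + 1 := by exact_mod_cast a
  have b' : m' i < m i + 1 := by exact_mod_cast b
  omega

lemma step_eq7 (d : ℕ) (C : ℝ) (f : (Fin d → ℝ) → ℝ) (k : ℕ) (x : Fin d → ℝ) :
    step7 d C f k x = 0 ∨ ∃ m ∈ idx7 d k, x ∈ hcube7 d k m ∧
      step7 d C f k x = (cnt7 d C f k m : ℝ) / 2 ^ k := by
  by_cases h : ∃ m ∈ idx7 d k, x ∈ hcube7 d k m
  · obtain ⟨m, hm, hx⟩ := h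
    refine Or.inr ⟨m, hm, hx, ?_⟩
    unfold step7
    rw [Finset.sum_eq_single_of_mem m hm, Set.indicator_of_mem hx]
    intro b _ hb
    exact Set.indicator_of_notMem (fun hxb => hb (hcube_unique7 d k m b x hx hxb)) _
  · left
    push Not at h
    exact Finset.sum_eq_zero fun m hm => Set.indicator_of_notMem (h m hm) _

lemma cnt_le7 (d : ℕ) (C : ℝ) (f : (Fin d → ℝ) → ℝ) (k : ℕ) (m : Fin d → ℕ) :
    (cnt7 d C f k m : ℝ) / 2 ^ k ≤ 1 := by
  classical
  rw [div_le_one (by positivity)]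
  have : cnt7 d C f k m ≤ 2 ^ k := by
    unfold cnt7
    exact (Finset.card_filter_le _ _).trans (by simp)
  exact_mod_cast this

lemma cnt_le_osc7 (d : ℕ) (C : ℝ) (hC : 0 < C) (f : (Fin d → ℝ) → ℝ) (k : ℕ) (m : Fin d → ℕ)
    (a e : ℝ) (he : 0 ≤ e) (hS : sSup (f '' dyadicCube d k m) ≤ a + e)
    (hI : a - e ≤ sInf (f '' dyadicCube d k m)) :
    (cnt7 d C f k m : ℝ) / 2 ^ k ≤ 2 * e / C + 2 / 2 ^ k := by
  classical
  have hp : (0 : ℝ) < 2 ^ k := by positivity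
  have key : (cnt7 d C f k m : ℝ) ≤ (a + e) * 2 ^ k / C - ((a - e) * 2 ^ k / C - 1) + 1 := by
    unfold cnt7
    apply card_le7
    · have : (a - e) * 2 ^ k / C ≤ (a + e) * 2 ^ k / C := by
        gcongr; linarith
      linarith
    · intro j hj
      obtain ⟨h1, h2⟩ := (Finset.mem_filter.1 hj).2
      have h3 := h1.trans hS
      have h4 := hI.trans h2
      rw [div_le_iff₀ hp] at h3
      rw [le_div_iff₀ hp] at h4
      constructor
      · rw [sub_le_iff_le_add, div_le_iff₀ hC]; exact h4
      · rw [le_div_iff₀ hC]; exact h3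
  rw [div_le_iff₀ hp]
  refine key.trans (le_of_eq ?_)
  field_simp
  ring

lemma step_tendsto7 (d : ℕ) (C : ℝ) (hC : 0 < C) (f : (Fin d → ℝ) → ℝ) (x : Fin d → ℝ)
    (hx : ContinuousWithinAt f (Set.Icc 0 1) x) :
    Filter.Tendsto (fun k => step7 d C f k x) Filter.atTop (nhds 0) := by
  rw [Metric.tendsto_atTop]
  intro ε hε
  set e := ε * C / 8 with he
  have hepos : 0 < e := by positivity
  obtain ⟨δ, hδ, hcl⟩ := Metric.continuousWithinAt_iff.1 hx e hepos
  have ht : Filter.Tendsto (fun k : ℕ => (1 / 2 : ℝ) ^ k) Filter.atTop (nhds 0) :=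
    tendsto_pow_atTop_nhds_zero_of_lt_one (by norm_num) (by norm_num)
  obtain ⟨K, hK⟩ := Filter.eventually_atTop.1
    ((ht.eventually_lt_const hδ).and (ht.eventually_lt_const (show (0 : ℝ) < ε / 4 by positivity)))
  refine ⟨K, fun k hk => ?_⟩
  obtain ⟨hk1, hk2⟩ := hK k hk
  rw [Real.dist_eq, sub_zero]
  rcases step_eq7 d C f k x with h | ⟨m, hm, hxm, h⟩
  · rw [h]; simpa using hε
  · rw [h, abs_of_nonneg (by positivity)]
    have hxc := hcube_sub7 d k m hxm
    have hb : ∀ y ∈ dyadicCube d k m, |f y - f x| < e := by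
      intro y hy
      have hd : dist y x < δ := by
        refine lt_of_le_of_lt ?_ hk1
        rw [dist_pi_le_iff (by positivity)]
        intro i
        have h1 := hy i
        have h2 := hxc i
        rw [add_div] at h1 h2
        rw [Real.dist_eq, abs_le, one_div, inv_pow, ← one_div]
        constructor <;> linarith [h1.1, h1.2, h2.1, h2.2]
      exact hcl (cube_sub7 d k m hm hy) hd
    have hne : (f '' dyadicCube d k m).Nonempty := ⟨f x, x, hxc, rfl⟩
    have hS : sSup (f '' dyadicCube d k m) ≤ f x + e := by
      apply csSup_le hne
      rintro _ ⟨y, hy, rfl⟩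
      linarith [(abs_lt.1 (hb y hy)).2]
    have hI : f x - e ≤ sInf (f '' dyadicCube d k m) := by
      apply le_csInf hne
      rintro _ ⟨y, hy, rfl⟩
      linarith [(abs_lt.1 (hb y hy)).1]
    have := cnt_le_osc7 d C hC f k m (f x) e hepos.le hS hI
    have e1 : 2 * e / C = ε / 4 := by rw [he]; field_simp; ring
    have e2 : (2 : ℝ) / 2 ^ k = 2 * (1 / 2) ^ k := by rw [one_div, inv_pow]; rfl
    rw [e1, e2] at this
    linarith

lemma hcube_meas7 (d k : ℕ) (m : Fin d → ℕ) : MeasurableSet (hcube7 d k m) :=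
  MeasurableSet.univ_pi fun _ => measurableSet_Ico

lemma hcube_vol7 (d k : ℕ) (m : Fin d → ℕ) (hm : m ∈ idx7 d k) :
    (volume.restrict (Set.Icc (0 : Fin d → ℝ) 1)).real (hcube7 d k m) = (1 / 2 ^ k) ^ d := by
  rw [measureReal_restrict_apply (hcube_meas7 d k m), Set.inter_eq_left.2
    ((hcube_sub7 d k m).trans (cube_sub7 d k m hm)), Measure.real, hcube7, Real.volume_pi_Ico,
    ENNReal.toReal_prod]
  have : ∀ i : Fin d, (ENNReal.ofReal (((m i : ℝ) + 1) / 2 ^ k - (m i : ℝ) / 2 ^ k)).toReal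
      = 1 / 2 ^ k := by
    intro i
    rw [← sub_div, add_sub_cancel_left, ENNReal.toReal_ofReal (by positivity)]
  simp [this]

lemma step_meas7 (d : ℕ) (C : ℝ) (f : (Fin d → ℝ) → ℝ) (k : ℕ) :
    Measurable (step7 d C f k) :=
  Finset.measurable_fun_sum _ fun m _ => measurable_const.indicator (hcube_meas7 d k m)

lemma integral_step7 (d : ℕ) (C : ℝ) (f : (Fin d → ℝ) → ℝ) (k : ℕ) :
    ∫ x in Set.Icc (0 : Fin d → ℝ) 1, step7 d C f k x
      = (Nvisited d C f k : ℝ) / 2 ^ ((d + 1) * k) := by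
  have hfin : IsFiniteMeasure (volume.restrict (Set.Icc (0 : Fin d → ℝ) 1)) :=
    ⟨by rw [Measure.restrict_apply_univ]; exact isCompact_Icc.measure_lt_top⟩
  unfold step7
  rw [integral_finsetSum _ fun m _ => (integrable_const _).indicator (hcube_meas7 d k m),
    nvisited_eq7, Nat.cast_sum, Finset.sum_div]
  refine Finset.sum_congr rfl fun m hm => ?_
  rw [integral_indicator_const _ (hcube_meas7 d k m), hcube_vol7 d k m hm, smul_eq_mul,
    one_div, inv_pow, ← pow_mul, add_mul, pow_add, one_mul, mul_comm k d]
  field_simp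

/-- Theorem 2, quantitative form: if `f` is continuous at Lebesgue-almost
every point of `[0,1]^d` (i.e. Riemann-integrable), then `N_k·2^{-(d+1)k} → 0`. -/
theorem stmt7 (d : ℕ) (hd : 1 ≤ d) (C : ℝ) (hC : 0 < C)
    (f : (Fin d → ℝ) → ℝ)
    (hf : ∀ x ∈ Set.Icc (0 : Fin d → ℝ) 1, f x ∈ Set.Icc 0 C)
    (hcont : volume {x ∈ Set.Icc (0 : Fin d → ℝ) 1 |
        ¬ ContinuousWithinAt f (Set.Icc 0 1) x} = 0) :
    Filter.Tendsto (fun k : ℕ => (Nvisited d C f k : ℝ) / 2 ^ ((d + 1) * k))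
      Filter.atTop (nhds 0) := by
  have hfin : IsFiniteMeasure (volume.restrict (Set.Icc (0 : Fin d → ℝ) 1)) :=
    ⟨by rw [Measure.restrict_apply_univ]; exact isCompact_Icc.measure_lt_top⟩
  have key := tendsto_integral_of_dominated_convergence
    (μ := volume.restrict (Set.Icc (0 : Fin d → ℝ) 1)) (F := fun k => step7 d C f k)
    (f := fun _ => (0 : ℝ)) (fun _ => (1 : ℝ))
    (fun k => (step_meas7 d C f k).aestronglyMeasurable) (integrable_const _)
    (fun k => Filter.Eventually.of_forall fun x => by
      rcases step_eq7 d C f k x with h | ⟨m, _, _, h⟩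
      · rw [h]; simp
      · rw [h, Real.norm_of_nonneg (by positivity)]
        exact cnt_le7 d C f k m)
    (by
      rw [ae_restrict_iff' measurableSet_Icc, ae_iff]
      refine measure_mono_null ?_ hcont
      intro x hx
      simp only [Set.mem_setOf_eq, Classical.not_imp] at hx
      exact ⟨hx.1, fun hc => hx.2 (step_tendsto7 d C hC f x hc)⟩)
  simpa only [integral_step7, integral_zero] using key
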